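/- For every q with 1 ≤ q < ∞, the function x ↦ E[|E − x|^q] on ℝ is continuously differentiable at x = 1 with derivative equal to 1 − E[|E − 1|^q], and moreover E[|E − 1|^q] = e^{−1} ( Γ(q + 1) + ∫_0^1 x^q e^x dx ), where Γ is the Gamma function. -/

import Mathlib

open MeasureTheory ProbabilityTheory Filter Topology Real

/-- The function `x ↦ 𝔼|E - x|^q` for a standard exponential random variable `E`. -/
noncomputable def absMomentExp (q : ℝ) (x : ℝ) : ℝ := ∫ t, |t - x| ^ q ∂(expMeasure 1)

lemma integral_expMeasure_one (f : ℝ → ℝ) :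
    ∫ t, f t ∂(expMeasure 1) = ∫ t in Set.Ioi (0 : ℝ), Real.exp (-t) * f t := by
  have h : ∫ t, f t ∂(expMeasure 1) = ∫ t, (exponentialPDF 1 t).toReal • f t := by
    unfold expMeasure gammaMeasure
    exact integral_withDensity_eq_integral_toReal_smul
      (measurable_exponentialPDFReal 1).ennreal_ofReal
      (ae_of_all _ fun _ ↦ ENNReal.ofReal_lt_top) f
  rw [h, ← integral_Ici_eq_integral_Ioi, ← integral_indicator measurableSet_Ici]
  congr 1 with t
  by_cases ht : 0 ≤ t
  · rw [exponentialPDF_of_nonneg ht, Set.indicator_of_mem (Set.mem_Ici.2 ht),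
      ENNReal.toReal_ofReal (by positivity)]
    simp
  · rw [exponentialPDF_of_neg (not_le.1 ht), Set.indicator_of_notMem (by simpa using ht)]
    simp

lemma absMomentExp_eq {q x : ℝ} (hq : 0 ≤ q) (hx : 0 ≤ x) :
    absMomentExp q x =
      Real.exp (-x) * (Real.Gamma (q + 1) + ∫ s in (0 : ℝ)..x, s ^ q * Real.exp s) := by
  have hcont : Continuous fun s : ℝ ↦ Real.exp (-s) * |s| ^ q := by fun_prop (disch := simp [hq])
  have hGamma : Set.EqOn (fun s : ℝ ↦ Real.exp (-s) * s ^ (q + 1 - 1))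
      (fun s ↦ Real.exp (-s) * |s| ^ q) (Set.Ioi 0) := fun s hs ↦ by
    simp [abs_of_pos (Set.mem_Ioi.1 hs)]
  have hint : IntegrableOn (fun s : ℝ ↦ Real.exp (-s) * |s| ^ q) (Set.Ioi 0) :=
    (Real.GammaIntegral_convergent (s := q + 1) (by linarith)).congr_fun hGamma measurableSet_Ioi
  have hshift : absMomentExp q x =
      Real.exp (-x) * ∫ s in Set.Ioi (-x), Real.exp (-s) * |s| ^ q := by
    rw [absMomentExp, integral_expMeasure_one, ← integral_const_mul,
      ← integral_indicator measurableSet_Ioi, ← integral_indicator measurableSet_Ioi,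
      ← integral_add_right_eq_self _ x]
    congr 1 with s
    by_cases hs : -x < s
    · rw [Set.indicator_of_mem (by simpa using by linarith),
        Set.indicator_of_mem (Set.mem_Ioi.2 hs), neg_add_rev, Real.exp_add, add_sub_cancel_right,
        mul_assoc]
    · rw [Set.indicator_of_notMem (by simpa using by linarith), Set.indicator_of_notMem (by simpa using hs)]
  rw [hshift, ← Set.Ioc_union_Ioi_eq_Ioi (neg_nonpos.2 hx),
    setIntegral_union (Set.Ioc_disjoint_Ioi le_rfl) measurableSet_Ioi
      (hcont.integrableOn_Ioc) hint,
    ← intervalIntegral.integral_of_le (neg_nonpos.2 hx),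
    Real.Gamma_eq_integral (by linarith), setIntegral_congr_fun measurableSet_Ioi hGamma,
    add_comm]
  congr 2
  rw [← neg_zero, ← intervalIntegral.integral_comp_neg, neg_zero]
  refine intervalIntegral.integral_congr fun s hs ↦ ?_
  rw [Set.uIcc_of_le hx] at hs
  simp [abs_of_nonneg hs.1, mul_comm]

lemma hasDerivAt_absMomentExp {q x : ℝ} (hq : 0 ≤ q) (hx : 0 < x) :
    HasDerivAt (absMomentExp q) (x ^ q - absMomentExp q x) x := by
  have hcont : Continuous fun s : ℝ ↦ s ^ q * Real.exp s := by fun_prop (disch := simp [hq])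
  have hI := (hcont.integral_hasStrictDerivAt 0 x).hasDerivAt
  have h := ((hasDerivAt_neg x).exp.mul (hI.const_add (Real.Gamma (q + 1)))).congr_of_eventuallyEq
    ((eventually_gt_nhds hx).mono fun y hy ↦ absMomentExp_eq hq hy.le)
  have he : Real.exp (-x) * Real.exp x = 1 := by rw [← Real.exp_add]; simp
  refine h.congr_deriv ?_
  rw [absMomentExp_eq hq hx.le]
  linear_combination x ^ q * he

/-- **Differentiability of `x ↦ 𝔼|E - x|^q` at `x = 1` and the value of `𝔼|E - 1|^q`.**
For `1 ≤ q < ∞`, the function `x ↦ 𝔼|E - x|^q` is continuously differentiable at `x = 1`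
with derivative `1 - 𝔼|E - 1|^q`, and `𝔼|E - 1|^q = e⁻¹ (Γ(q + 1) + ∫_0^1 x^q e^x dx)`. -/
theorem deriv_absMomentExp_at_one (q : ℝ) (hq : 1 ≤ q) :
    HasDerivAt (absMomentExp q) (1 - absMomentExp q 1) 1 ∧
      ContinuousAt (deriv (absMomentExp q)) 1 ∧
      absMomentExp q 1 =
        (Real.exp 1)⁻¹ * (Real.Gamma (q + 1) + ∫ x in (0:ℝ)..1, x ^ q * Real.exp x) := by
  have hq0 : 0 ≤ q := zero_le_one.trans hq
  have h1 := hasDerivAt_absMomentExp hq0 one_pos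
  refine ⟨by simpa using h1, ?_, by rw [absMomentExp_eq hq0 zero_le_one, Real.exp_neg]⟩
  have hcont : ContinuousAt (fun x ↦ x ^ q - absMomentExp q x) 1 :=
    (Real.continuousAt_rpow_const 1 q (Or.inr hq0)).sub h1.continuousAt
  exact hcont.congr ((eventually_gt_nhds one_pos).mono
    fun x hx ↦ (hasDerivAt_absMomentExp hq0 hx).deriv.symm)
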